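/- arXiv:1710.01880 — 2 statements merged into one kernel-verified Lean document; each statement's English description precedes it below -/
import Mathlib

section
/- There exists a constant C > 0 such that for all ε small and all admissible parameters: |∫_{Ω_ε}|Q_A|^{p+1} dx − ∫_{ℝⁿ}|Q|^{p+1} dz| ≤ C·ε^{n/2}. -/
open MeasureTheory Metric Set Filter RealInnerProductSpace

noncomputable section

abbrev Euc (n : ℕ) := EuclideanSpace ℝ (Fin n)

/-- The critical Sobolev exponent `p = (n+2)/(n-2)`. -/
def pexp (n : ℕ) : ℝ := ((n : ℝ) + 2) / ((n : ℝ) - 2)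

/-- The conformally transformed function `Q_A`, for `A = (λ, ξ, a, θ)`:
`Q_A(x) = λ^{-(n-2)/2} |(x-ξ)/|x-ξ| - R_θ a |x-ξ|/λ|^{2-n}
  Q( ((x-ξ)/λ - R_θ a |(x-ξ)/λ|²) / (1 - 2 R_θ a·(x-ξ)/λ + |a|² |(x-ξ)/λ|²) )`. -/
def QA {n : ℕ} (Q : Euc n → ℝ) (lam : ℝ) (ξ : Euc n) (a : Euc n)
    (R : Euc n ≃ₗᵢ[ℝ] Euc n) (x : Euc n) : ℝ :=
  lam ^ (-(((n : ℝ) - 2) / 2)) *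
    ‖(‖x - ξ‖⁻¹) • (x - ξ) - (‖x - ξ‖ / lam) • (R a)‖ ^ ((2 : ℝ) - n) *
    Q ((1 - 2 * ⟪R a, lam⁻¹ • (x - ξ)⟫ + ‖a‖ ^ 2 * ‖lam⁻¹ • (x - ξ)‖ ^ 2)⁻¹ •
        (lam⁻¹ • (x - ξ) - ‖lam⁻¹ • (x - ξ)‖ ^ 2 • (R a)))


lemma inv_integral {n : ℕ} (hn : 3 ≤ n) (f : Euc n → ℝ) :
    ∫ y : Euc n, f y = ∫ y : Euc n, (‖y‖ ^ (2 * n))⁻¹ * f ((‖y‖ ^ 2)⁻¹ • y) := by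
  have : Nontrivial (Euc n) := by
    have : Nonempty (Fin n) := ⟨⟨0, by omega⟩⟩
    infer_instance
  have hinv : ∀ y : Euc n, EuclideanGeometry.inversion 0 1 y = (‖y‖ ^ 2)⁻¹ • y := by
    intro y
    simp [EuclideanGeometry.inversion]
  have himg : (EuclideanGeometry.inversion (0 : Euc n) 1) '' {0}ᶜ = {0}ᶜ := by
    ext y
    constructor
    · rintro ⟨x, hx, rfl⟩
      simp only [mem_compl_iff, mem_singleton_iff] at hx ⊢
      rwa [EuclideanGeometry.inversion_eq_center one_ne_zero]
    · intro hy
      refine ⟨EuclideanGeometry.inversion 0 1 y, ?_, ?_⟩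
      · simp only [mem_compl_iff, mem_singleton_iff] at hy ⊢
        rwa [EuclideanGeometry.inversion_eq_center one_ne_zero]
      · exact EuclideanGeometry.inversion_inversion _ one_ne_zero _
  have key := integral_image_eq_integral_abs_det_fderiv_smul (volume : Measure (Euc n))
    (s := {0}ᶜ) (f := EuclideanGeometry.inversion (0 : Euc n) 1)
    (f' := fun x => ((1 / dist x 0) ^ 2 • ((Submodule.span ℝ {x - 0})ᗮ.reflection : Euc n →L[ℝ] Euc n)))
    (measurableSet_singleton _).compl
    (fun x hx => (EuclideanGeometry.hasFDerivAt_inversion (by simpa using hx)).hasFDerivWithinAt)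
    ((EuclideanGeometry.inversion_injective (0 : Euc n) one_ne_zero).injOn) f
  rw [himg] at key
  have h0 : (volume : Measure (Euc n)).restrict {0}ᶜ = volume := by
    rw [Measure.restrict_eq_self_of_ae_mem]
    simp [ae_iff]
  rw [h0] at key
  rw [key]
  congr 1
  ext x
  rw [hinv, smul_eq_mul]
  congr 1
  have hd : (((1 / dist x 0) ^ 2 • ((Submodule.span ℝ {x - 0})ᗮ.reflection : Euc n →L[ℝ] Euc n))).det
      = ((1 / dist x 0) ^ 2) ^ n * LinearMap.det ((Submodule.span ℝ {x - 0})ᗮ.reflection.toLinearMap) := by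
    rw [ContinuousLinearMap.det, ContinuousLinearMap.toLinearMap_smul, LinearMap.det_smul]
    simp only [finrank_euclideanSpace_fin]
    rfl
  rw [hd, Submodule.det_reflection, abs_mul, abs_pow (-1)]
  simp [pow_mul]

/-- The rescaled density. -/
def Hd {n : ℕ} (g : Euc n → ℝ) (b : Euc n) (y : Euc n) : ℝ :=
  (‖(‖y‖⁻¹) • y - ‖y‖ • b‖ ^ (2 * n))⁻¹ *
    g ((1 - 2 * ⟪b, y⟫ + ‖b‖ ^ 2 * ‖y‖ ^ 2)⁻¹ • (y - ‖y‖ ^ 2 • b))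

lemma N_sq {n : ℕ} (b y : Euc n) (hy : y ≠ 0) :
    ‖(‖y‖⁻¹) • y - ‖y‖ • b‖ ^ 2 = 1 - 2 * ⟪b, y⟫ + ‖b‖ ^ 2 * ‖y‖ ^ 2 := by
  have : ‖y‖ ≠ 0 := norm_ne_zero_iff.2 hy
  rw [norm_sub_sq_real, norm_smul, norm_smul, inner_smul_left, inner_smul_right,
    real_inner_comm b y]
  simp
  field_simp

lemma N_eq {n : ℕ} (b y : Euc n) (hy : y ≠ 0) :
    ‖(‖y‖⁻¹) • y - ‖y‖ • b‖ = ‖y‖ * ‖(‖y‖ ^ 2)⁻¹ • y - b‖ := by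
  have : ‖y‖ ≠ 0 := norm_ne_zero_iff.2 hy
  have h : (‖y‖⁻¹) • y - ‖y‖ • b = ‖y‖ • ((‖y‖ ^ 2)⁻¹ • y - b) := by
    rw [smul_sub, smul_smul]
    congr 2
    field_simp
  rw [h, norm_smul, norm_norm]

lemma num_eq {n : ℕ} (b y : Euc n) :
    ‖y - ‖y‖ ^ 2 • b‖ = ‖y‖ * ‖(‖y‖⁻¹) • y - ‖y‖ • b‖ := by
  by_cases hy : y = 0
  · simp [hy]
  have : ‖y‖ ≠ 0 := norm_ne_zero_iff.2 hy
  have h : y - ‖y‖ ^ 2 • b = ‖y‖ • ((‖y‖⁻¹) • y - ‖y‖ • b) := by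
    rw [smul_sub, smul_smul, smul_smul, mul_inv_cancel₀ this, one_smul, sq]
  rw [h, norm_smul, norm_norm]

lemma ae_ne_zero {n : ℕ} (hn : 3 ≤ n) : ∀ᵐ y : Euc n, y ≠ 0 := by
  have : Nontrivial (Euc n) := by
    have : Nonempty (Fin n) := ⟨⟨0, by omega⟩⟩
    infer_instance
  simp [ae_iff]

lemma Hd_integral {n : ℕ} (hn : 3 ≤ n) (g : Euc n → ℝ) (b : Euc n) :
    ∫ y, Hd g b y = ∫ y, g y := by
  rw [inv_integral hn g,
    ← integral_sub_right_eq_self (fun u : Euc n => (‖u‖ ^ (2 * n))⁻¹ * g ((‖u‖ ^ 2)⁻¹ • u)) b,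
    inv_integral hn
      (fun u : Euc n => (‖u - b‖ ^ (2 * n))⁻¹ * g ((‖u - b‖ ^ 2)⁻¹ • (u - b)))]
  apply integral_congr_ae
  filter_upwards [ae_ne_zero hn] with y hy
  have h0 : ‖y‖ ≠ 0 := norm_ne_zero_iff.2 hy
  have h1 := N_sq b y hy
  have h2 := N_eq b y hy
  unfold Hd
  rw [← h1, h2, mul_pow, mul_inv, mul_assoc]
  congr 3
  rw [mul_pow, mul_inv, mul_comm, mul_smul]
  congr 1
  rw [smul_sub, smul_smul, inv_mul_cancel₀ (by positivity), one_smul]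

lemma Hd_nonneg {n : ℕ} (g : Euc n → ℝ) (hg : ∀ y, 0 ≤ g y) (b y : Euc n) : 0 ≤ Hd g b y :=
  mul_nonneg (by positivity) (hg _)

lemma Hd_bound {n : ℕ} (hn : 3 ≤ n) (g : Euc n → ℝ) (K : ℝ) (hK : 0 ≤ K)
    (hg : ∀ y, g y ≤ K * ((1 + ‖y‖) ^ (2 * n))⁻¹) (b y : Euc n) (hb : ‖b‖ ≤ 1 / 2) :
    Hd g b y ≤ K * 2 ^ (2 * n) * ((1 + ‖y‖) ^ (2 * n))⁻¹ := by
  set N := ‖(‖y‖⁻¹) • y - ‖y‖ • b‖ with hN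
  have hN0 : 0 ≤ N := norm_nonneg _
  rcases hN0.eq_or_lt with h | h
  · have : Hd g b y = 0 := by
      unfold Hd
      rw [← hN, ← h, zero_pow (by omega)]; simp
    rw [this]; positivity
  · have hy : y ≠ 0 := by
      rintro rfl
      simp [hN] at h
    have hy0 : 0 < ‖y‖ := norm_pos_iff.2 hy
    have h1 := N_sq b y hy
    have h3 := num_eq b y
    rw [← hN] at h1 h3
    have hlow : (1 + ‖y‖) / 2 ≤ N + ‖y‖ := by
      have := norm_sub_norm_le ((‖y‖⁻¹) • y) (‖y‖ • b)
      rw [← hN, norm_smul, norm_smul, norm_inv, norm_norm, inv_mul_cancel₀ hy0.ne'] at this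
      nlinarith
    unfold Hd
    rw [← hN, ← h1]
    have hT : ‖(N ^ 2)⁻¹ • (y - ‖y‖ ^ 2 • b)‖ = ‖y‖ / N := by
      rw [norm_smul, h3, norm_inv, norm_pow, Real.norm_of_nonneg hN0]
      field_simp
    calc (N ^ (2 * n))⁻¹ * g ((N ^ 2)⁻¹ • (y - ‖y‖ ^ 2 • b))
        ≤ (N ^ (2 * n))⁻¹ * (K * ((1 + ‖y‖ / N) ^ (2 * n))⁻¹) := by
          gcongr
          rw [← hT]; exact hg _
      _ = K * ((N + ‖y‖) ^ (2 * n))⁻¹ := by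
          have : N + ‖y‖ = N * (1 + ‖y‖ / N) := by field_simp
          rw [this, mul_pow, mul_inv]; ring
      _ ≤ K * (((1 + ‖y‖) / 2) ^ (2 * n))⁻¹ := by gcongr
      _ = _ := by rw [div_pow, inv_div]; ring

lemma bracket_integrable {n : ℕ} (hn : 3 ≤ n) :
    Integrable (fun y : Euc n => ((1 + ‖y‖) ^ (2 * n))⁻¹) := by
  have h := integrable_one_add_norm (E := Euc n) (μ := volume) (r := ((2 * n : ℕ) : ℝ)) (by
    simp only [finrank_euclideanSpace_fin]
    exact_mod_cast (by omega : n < 2 * n))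
  refine h.congr (ae_of_all _ fun y => ?_)
  simp only
  rw [Real.rpow_neg (by positivity), Real.rpow_natCast]

lemma Hd_integrable {n : ℕ} (hn : 3 ≤ n) (g : Euc n → ℝ) (hgm : Continuous g)
    (hg0 : ∀ y, 0 ≤ g y) (K : ℝ) (hK : 0 ≤ K)
    (hg : ∀ y, g y ≤ K * ((1 + ‖y‖) ^ (2 * n))⁻¹) (b : Euc n) (hb : ‖b‖ ≤ 1 / 2) :
    Integrable (Hd g b) := by
  refine ((bracket_integrable hn).const_mul (K * 2 ^ (2 * n))).mono' ?_ (ae_of_all _ fun y => ?_)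
  · have hgm' := hgm.measurable
    unfold Hd
    apply Measurable.aestronglyMeasurable
    refine Measurable.mul (by fun_prop) (hgm'.comp ?_)
    fun_prop
  · rw [Real.norm_of_nonneg (Hd_nonneg g hg0 b y)]
    exact Hd_bound hn g K hK hg b y hb

lemma QA_pow {n : ℕ} (hn : 3 ≤ n) (Q : Euc n → ℝ) (lam : ℝ) (hl : 0 < lam) (ξ a : Euc n)
    (R : Euc n ≃ₗᵢ[ℝ] Euc n) (x : Euc n) :
    |QA Q lam ξ a R x| ^ (pexp n + 1) =
      (lam ^ n)⁻¹ * Hd (fun z => |Q z| ^ (pexp n + 1)) (R a) (lam⁻¹ • (x - ξ)) := by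
  have hn2 : (0 : ℝ) < (n : ℝ) - 2 := by
    have : (3 : ℝ) ≤ n := by exact_mod_cast hn
    linarith
  have hp : pexp n + 1 = 2 * n / ((n : ℝ) - 2) := by
    unfold pexp; field_simp; ring
  have hN : ‖(‖x - ξ‖⁻¹) • (x - ξ) - (‖x - ξ‖ / lam) • (R a)‖ =
      ‖(‖lam⁻¹ • (x - ξ)‖⁻¹) • (lam⁻¹ • (x - ξ)) - ‖lam⁻¹ • (x - ξ)‖ • (R a)‖ := by
    rw [norm_smul, norm_inv, Real.norm_of_nonneg hl.le, smul_smul]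
    congr 3
    · rw [mul_inv, inv_inv]; field_simp
    · rw [div_eq_inv_mul]
  unfold QA Hd
  rw [hN, abs_mul, abs_mul, Real.mul_rpow (by positivity) (by positivity),
    Real.mul_rpow (by positivity) (by positivity), LinearIsometryEquiv.norm_map, mul_assoc]
  congr 1
  · rw [abs_of_nonneg (by positivity), ← Real.rpow_mul hl.le, ← Real.rpow_natCast,
      ← Real.rpow_neg hl.le, hp]
    congr 1
    field_simp
  · congr 1
    have h0 := norm_nonneg ((‖lam⁻¹ • (x - ξ)‖⁻¹) • (lam⁻¹ • (x - ξ)) - ‖lam⁻¹ • (x - ξ)‖ • (R a))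
    rw [abs_of_nonneg (by positivity), ← Real.rpow_mul h0, ← Real.rpow_natCast,
      ← Real.rpow_neg h0, hp]
    congr 1
    push_cast
    field_simp
    ring

set_option maxHeartbeats 2000000

/-- There is `C > 0` such that for all small `ε` and all admissible parameters,
`|∫_{Ω_ε} |Q_A|^{p+1} dx - ∫_{ℝⁿ} |Q|^{p+1} dz| ≤ C ε^{n/2}`. -/
theorem statement3 (n : ℕ) (hn : 3 ≤ n) (Ω : Set (Euc n))
    (hΩopen : IsOpen Ω) (hΩbd : Bornology.IsBounded Ω) (h0Ω : (0 : Euc n) ∈ Ω)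
    (Q : Euc n → ℝ) (hQcont : Continuous Q) (C₀ : ℝ) (hC₀ : 0 < C₀)
    (hQdec : ∀ y : Euc n, |Q y| ≤ C₀ * (1 + ‖y‖) ^ (-((n : ℝ) - 2)))
    (hKelvin : ∀ y : Euc n, y ≠ 0 → Q y = ‖y‖ ^ ((2 : ℝ) - n) * Q ((‖y‖ ^ 2)⁻¹ • y))
    (η : ℝ) (hη : 0 < η) :
    ∃ C : ℝ, 0 < C ∧ ∃ ε₀ : ℝ, 0 < ε₀ ∧
      ∀ (ε d lam : ℝ) (τ a : Euc n) (R : Euc n ≃ₗᵢ[ℝ] Euc n),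
        0 < ε → ε < ε₀ → η < d → d < η⁻¹ → lam = d * Real.sqrt ε → ‖τ‖ < η →
        (∀ i : Fin n, 2 ≤ (i : ℕ) → a i = 0) → ‖a‖ < 1 / 2 →
        LinearMap.det (R.toLinearEquiv.toLinearMap) = 1 →
        |(∫ x in Ω \ Metric.closedBall 0 ε, |QA Q lam (lam • τ) a R x| ^ (pexp n + 1))
          - ∫ z : Euc n, |Q z| ^ (pexp n + 1)|
        ≤ C * ε ^ ((n : ℝ) / 2) := by
  have hn2 : (0 : ℝ) < (n : ℝ) - 2 := by
    have : (3 : ℝ) ≤ n := by exact_mod_cast hn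
    linarith
  have hp : pexp n + 1 = 2 * n / ((n : ℝ) - 2) := by
    unfold pexp; field_simp; ring
  have hp0 : 0 < pexp n + 1 := by rw [hp]; positivity
  set q := pexp n + 1 with hq
  set g : Euc n → ℝ := fun z => |Q z| ^ q with hgdef
  have hg0 : ∀ y, 0 ≤ g y := fun y => by positivity
  have hgc : Continuous g := hQcont.abs.rpow_const (fun _ => Or.inr hp0.le)
  set K : ℝ := C₀ ^ q with hKdef
  have hK : 0 ≤ K := by positivity
  have hg : ∀ y, g y ≤ K * ((1 + ‖y‖) ^ (2 * n))⁻¹ := by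
    intro y
    have h1 : (0 : ℝ) ≤ 1 + ‖y‖ := by positivity
    calc g y ≤ (C₀ * (1 + ‖y‖) ^ (-((n : ℝ) - 2))) ^ q :=
          Real.rpow_le_rpow (abs_nonneg _) (hQdec y) hp0.le
      _ = K * ((1 + ‖y‖) ^ (2 * n))⁻¹ := by
          rw [Real.mul_rpow hC₀.le (by positivity), ← Real.rpow_mul h1, ← Real.rpow_natCast,
            ← Real.rpow_neg h1]
          have hexp : -((n : ℝ) - 2) * q = -((2 * n : ℕ) : ℝ) := by
            rw [hp]
            push_cast
            field_simp
          rw [hexp]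
  obtain ⟨r, hr, hrΩ⟩ := Metric.isOpen_iff.1 hΩopen 0 h0Ω
  set J : ℝ := ∫ y : Euc n, ((1 + ‖y‖) ^ (2 * n))⁻¹ with hJ
  have hJ0 : 0 ≤ J := integral_nonneg fun y => by positivity
  set V : ℝ := (volume : Measure (Euc n)).real (closedBall 0 1) with hV
  have hV0 : 0 ≤ V := measureReal_nonneg
  set K1 := K * 2 ^ (2 * n) with hK1
  have hK10 : 0 ≤ K1 := by positivity
  set M : ℝ := K1 * (2 * (1 + r) / r) ^ (2 * n) with hM
  have hM0 : 0 ≤ M := by positivity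
  refine ⟨K1 * (η⁻¹) ^ n * V + M * (η⁻¹) ^ n * J + 1, by positivity, (r / 2) ^ 2, by positivity, ?_⟩
  intro ε d lam τ a R hε hεr hηd hdη hlam hτ _ ha _
  have hsε : 0 < Real.sqrt ε := Real.sqrt_pos.2 hε
  have hd : 0 < d := hη.trans hηd
  have hl : 0 < lam := by rw [hlam]; positivity
  have hεn : ε ^ ((n : ℝ) / 2) = Real.sqrt ε ^ n := by
    rw [Real.sqrt_eq_rpow, ← Real.rpow_natCast, ← Real.rpow_mul hε.le]
    congr 1; ring
  set E := Real.sqrt ε ^ n with hE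
  have hE0 : 0 < E := by positivity
  have hb : ‖R a‖ ≤ 1 / 2 := by rw [LinearIsometryEquiv.norm_map]; exact ha.le
  set b := R a with hbdef
  set ξ := lam • τ with hξ
  have hξn : ‖ξ‖ ≤ r / 2 := by
    rw [hξ, norm_smul, Real.norm_of_nonneg hl.le, hlam]
    have h1 : d * ‖τ‖ ≤ 1 := by
      calc d * ‖τ‖ ≤ η⁻¹ * η := by gcongr
        _ = 1 := inv_mul_cancel₀ hη.ne'
    have h2 : Real.sqrt ε ≤ r / 2 := by
      rw [Real.sqrt_le_left (by positivity)]; exact hεr.le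
    calc d * Real.sqrt ε * ‖τ‖ = (d * ‖τ‖) * Real.sqrt ε := by ring
      _ ≤ 1 * Real.sqrt ε := by gcongr
      _ ≤ r / 2 := by simpa using h2
  set F : Euc n → ℝ := fun x => (lam ^ n)⁻¹ * Hd g b (lam⁻¹ • (x - ξ)) with hF
  have hFQ : (fun x => |QA Q lam ξ a R x| ^ q) = F := by
    ext x
    exact QA_pow hn Q lam hl ξ a R x
  have hF0 : ∀ x, 0 ≤ F x := fun x => mul_nonneg (by positivity) (Hd_nonneg g hg0 _ _)
  have hFint : Integrable F := by
    have h1 := Hd_integrable hn g hgc hg0 K hK hg b hb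
    have h2 := h1.comp_smul (inv_ne_zero hl.ne')
    exact (h2.comp_sub_right ξ).const_mul _
  have hFeq : ∫ x, F x = ∫ z, g z := by
    rw [hF, integral_const_mul, integral_sub_right_eq_self (fun x => Hd g b (lam⁻¹ • x)) ξ,
      Measure.integral_comp_inv_smul_of_nonneg _ _ hl.le, Hd_integral hn]
    simp only [finrank_euclideanSpace_fin, smul_eq_mul]
    rw [← mul_assoc, inv_mul_cancel₀ (by positivity), one_mul]
  set S := Ω \ Metric.closedBall (0 : Euc n) ε with hS
  have hSm : MeasurableSet S := hΩopen.measurableSet.diff isClosed_closedBall.measurableSet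
  have hsplit := integral_add_compl hSm hFint
  have hsub : Sᶜ ⊆ closedBall 0 ε ∪ (ball 0 r)ᶜ := by
    intro x hx
    by_cases h : x ∈ closedBall (0 : Euc n) ε
    · exact Or.inl h
    · exact Or.inr fun h' => hx ⟨hrΩ h', h⟩
  have hbr := bracket_integrable hn
  have hle : ∀ x, x ∈ Sᶜ → F x ≤ (closedBall (0 : Euc n) ε).indicator (fun _ => (lam ^ n)⁻¹ * K1) x
      + M * lam ^ n * ((1 + ‖x‖) ^ (2 * n))⁻¹ := by
    intro x hx
    have hHb := Hd_bound hn g K hK hg b (lam⁻¹ • (x - ξ)) hb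
    rcases hsub hx with h | h
    · rw [indicator_of_mem h]
      have : F x ≤ (lam ^ n)⁻¹ * K1 := by
        refine mul_le_mul_of_nonneg_left (hHb.trans ?_) (by positivity)
        refine mul_le_of_le_one_right hK10 (inv_le_one_of_one_le₀ (one_le_pow₀ ?_))
        linarith [norm_nonneg (lam⁻¹ • (x - ξ))]
      have h2 : 0 ≤ M * lam ^ n * ((1 + ‖x‖) ^ (2 * n))⁻¹ := by positivity
      linarith
    · have hxr : r ≤ ‖x‖ := by simpa using h
      have hx0 : 0 < ‖x‖ := hr.trans_le hxr
      have hind : 0 ≤ (closedBall (0 : Euc n) ε).indicator (fun _ => (lam ^ n)⁻¹ * K1) x :=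
        indicator_nonneg (fun _ _ => by positivity) x
      have h1 : ‖x‖ / 2 ≤ ‖x - ξ‖ := by
        have := norm_sub_norm_le x ξ
        linarith
      have h2 : (1 + ‖x‖) * (lam⁻¹ * (r / (2 * (1 + r)))) ≤ 1 + ‖lam⁻¹ • (x - ξ)‖ := by
        rw [norm_smul, norm_inv, Real.norm_of_nonneg hl.le]
        have h3 : (1 + ‖x‖) * (r / (2 * (1 + r))) ≤ ‖x‖ / 2 := by
          rw [← mul_div_assoc, div_le_div_iff₀ (by positivity) (by positivity)]
          nlinarith
        calc (1 + ‖x‖) * (lam⁻¹ * (r / (2 * (1 + r)))) = lam⁻¹ * ((1 + ‖x‖) * (r / (2 * (1 + r)))) := by ring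
          _ ≤ lam⁻¹ * ‖x - ξ‖ := by gcongr; linarith
          _ ≤ _ := by linarith
      have h4 : F x ≤ M * lam ^ n * ((1 + ‖x‖) ^ (2 * n))⁻¹ := by
        calc F x ≤ (lam ^ n)⁻¹ * (K1 * ((1 + ‖lam⁻¹ • (x - ξ)‖) ^ (2 * n))⁻¹) :=
              mul_le_mul_of_nonneg_left hHb (by positivity)
          _ ≤ (lam ^ n)⁻¹ * (K1 * (((1 + ‖x‖) * (lam⁻¹ * (r / (2 * (1 + r))))) ^ (2 * n))⁻¹) := by
              gcongr
          _ = _ := by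
              rw [hM, mul_pow, mul_pow, mul_inv, mul_inv, ← inv_pow (lam⁻¹), inv_inv,
                ← inv_pow (r / _), inv_div, two_mul n, pow_add lam]
              field_simp
      linarith
  have hindint : Integrable ((closedBall (0 : Euc n) ε).indicator (fun _ => (lam ^ n)⁻¹ * K1)) :=
    (integrable_indicator_iff isClosed_closedBall.measurableSet).2
      (integrableOn_const measure_closedBall_lt_top.ne)
  have hGint := hindint.add (hbr.const_mul (M * lam ^ n))
  have hG0 : ∀ x, 0 ≤ (closedBall (0 : Euc n) ε).indicator (fun _ => (lam ^ n)⁻¹ * K1) x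
      + M * lam ^ n * ((1 + ‖x‖) ^ (2 * n))⁻¹ := fun x =>
    add_nonneg (indicator_nonneg (fun _ _ => by positivity) x) (by positivity)
  have hbound : ∫ x in Sᶜ, F x ≤ (lam ^ n)⁻¹ * K1 * (ε ^ n * V) + M * lam ^ n * J := by
    calc ∫ x in Sᶜ, F x ≤ ∫ x in Sᶜ, ((closedBall (0 : Euc n) ε).indicator (fun _ => (lam ^ n)⁻¹ * K1) x
      + M * lam ^ n * ((1 + ‖x‖) ^ (2 * n))⁻¹) :=
          setIntegral_mono_on hFint.integrableOn hGint.integrableOn hSm.compl hle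
      _ ≤ ∫ x, ((closedBall (0 : Euc n) ε).indicator (fun _ => (lam ^ n)⁻¹ * K1) x
      + M * lam ^ n * ((1 + ‖x‖) ^ (2 * n))⁻¹) :=
          setIntegral_le_integral hGint (ae_of_all _ hG0)
      _ = _ := by
          rw [integral_add hindint (hbr.const_mul _), integral_const_mul,
            integral_indicator isClosed_closedBall.measurableSet, setIntegral_const,
            Measure.addHaar_real_closedBall' _ _ hε.le]
          simp only [finrank_euclideanSpace_fin, smul_eq_mul]
          ring
  have hlE : lam ^ n ≤ η⁻¹ ^ n * E := by
    rw [hlam, mul_pow]; gcongr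
  have hlE2 : (lam ^ n)⁻¹ * ε ^ n ≤ η⁻¹ ^ n * E := by
    have : ε ^ n = E * E := by
      rw [hE, ← mul_pow, Real.mul_self_sqrt hε.le]
    rw [this, hlam, mul_pow, mul_inv, ← hE, ← inv_pow]
    calc d⁻¹ ^ n * E⁻¹ * (E * E) = d⁻¹ ^ n * E := by field_simp
      _ ≤ _ := by gcongr
  have hn0 : 0 ≤ ∫ x in Sᶜ, F x := integral_nonneg hF0
  rw [hεn, hFQ, ← hFeq, ← hsplit, abs_sub_comm, add_sub_cancel_left, abs_of_nonneg hn0]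
  calc ∫ x in Sᶜ, F x ≤ (lam ^ n)⁻¹ * K1 * (ε ^ n * V) + M * lam ^ n * J := hbound
    _ = K1 * V * ((lam ^ n)⁻¹ * ε ^ n) + M * J * lam ^ n := by ring
    _ ≤ K1 * V * (η⁻¹ ^ n * E) + M * J * (η⁻¹ ^ n * E) := by gcongr
    _ ≤ (K1 * η⁻¹ ^ n * V + M * η⁻¹ ^ n * J + 1) * E := by nlinarith
end
end

section
/- For every fixed small δ > 0 there exists C > 0 such that for all ε small and all admissible parameters: |∫_{ε<|x|<δ} |Q_A(x)|^{p−1}Q_A(x) dx − λ^{(n−2)/2}·∫_{ℝⁿ}|z + R_θ a|^{−(n−2)}·|Q(z)|^{p−1}Q(z) dz| ≤ C·λ^{(n+2)/2}. -/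
open MeasureTheory Metric Set Filter RealInnerProductSpace

noncomputable section

/-- The inversion. -/
def iv {n : ℕ} (y : Euc n) : Euc n := (‖y‖ ^ 2)⁻¹ • y

/-- The nonlinearity. -/
def ff {n : ℕ} (Q : Euc n → ℝ) (z : Euc n) : ℝ := |Q z| ^ (pexp n - 1) * Q z

/-- The rescaled integrand. -/
def gg {n : ℕ} (Q : Euc n → ℝ) (b : Euc n) (y : Euc n) : ℝ :=
  ‖y‖ ^ (-((n : ℝ) + 2)) * ff Q (iv y - b)

lemma iv_eq {n : ℕ} : (iv : Euc n → Euc n) = EuclideanGeometry.inversion 0 1 := by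
  funext y
  simp [iv, EuclideanGeometry.inversion]

lemma norm_iv {n : ℕ} (y : Euc n) : ‖iv y‖ = ‖y‖⁻¹ := by
  by_cases hy : y = 0
  · simp [hy, iv]
  have : ‖y‖ ≠ 0 := norm_ne_zero_iff.2 hy
  rw [iv, norm_smul]
  simp
  field_simp

lemma iv_iv {n : ℕ} (y : Euc n) : iv (iv y) = y := by
  rw [iv_eq]
  exact EuclideanGeometry.inversion_involutive 0 one_ne_zero y

lemma integral_iv {n : ℕ} (hn : 3 ≤ n) (F : Euc n → ℝ) :
    ∫ u, F u = ∫ y : Euc n, (‖y‖⁻¹ ^ 2) ^ n * F (iv y) := by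
  have : Nonempty (Fin n) := ⟨⟨0, by omega⟩⟩
  have himg : (iv : Euc n → Euc n) '' {0}ᶜ = {0}ᶜ := by
    ext z
    constructor
    · rintro ⟨y, hy, rfl⟩
      simp only [mem_compl_iff, mem_singleton_iff] at hy ⊢
      rw [← norm_eq_zero, norm_iv]
      simpa using hy
    · intro hz
      refine ⟨iv z, ?_, iv_iv z⟩
      simp only [mem_compl_iff, mem_singleton_iff] at hz ⊢
      rw [← norm_eq_zero, norm_iv]
      simpa using hz
  have hinj : InjOn (iv : Euc n → Euc n) {0}ᶜ := fun x _ y _ h => by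
    rw [← iv_iv x, h, iv_iv]
  have key := integral_image_eq_integral_abs_det_fderiv_smul (volume : Measure (Euc n))
    (s := {0}ᶜ) (f := iv)
    (f' := fun x => (1 / dist x (0 : Euc n)) ^ 2 • (((ℝ ∙ (x - 0))ᗮ).reflection : Euc n →L[ℝ] Euc n))
    (measurableSet_singleton _).compl
    (fun x hx => by
      rw [iv_eq]
      exact (EuclideanGeometry.hasFDerivAt_inversion (by simpa using hx)).hasFDerivWithinAt) hinj F
  rw [himg] at key
  have hr : (volume : Measure (Euc n)).restrict {0}ᶜ = volume :=
    Measure.restrict_eq_self_of_ae_mem (by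
      rw [ae_iff]
      simp)
  rw [hr] at key
  rw [key]
  congr 1
  funext y
  rw [smul_eq_mul]
  congr 1
  have h1 : ∀ (K : Submodule ℝ (Euc n)), |LinearMap.det (K.reflection.toLinearMap)| = 1 := by
    intro K
    rw [Submodule.det_reflection]
    simp
  rw [ContinuousLinearMap.det]
  have h2 : ((((1 / dist y (0 : Euc n)) ^ 2 • (((ℝ ∙ (y - 0))ᗮ).reflection : Euc n →L[ℝ] Euc n)) : Euc n →L[ℝ] Euc n) : Euc n →ₗ[ℝ] Euc n)
    = (1 / dist y (0 : Euc n)) ^ 2 • (((ℝ ∙ (y - 0))ᗮ).reflection.toLinearMap) := rfl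
  rw [h2, LinearMap.det_smul, abs_mul, h1]
  simp

lemma integral_gg {n : ℕ} (hn : 3 ≤ n) (Q : Euc n → ℝ) (b : Euc n) :
    ∫ z : Euc n, ‖z + b‖ ^ (-((n : ℝ) - 2)) * |Q z| ^ (pexp n - 1) * Q z = ∫ y, gg Q b y := by
  have h := integral_iv hn (fun u : Euc n => ‖u‖ ^ (-((n : ℝ) - 2)) * ff Q (u - b))
  have h' := integral_add_right_eq_self (μ := (volume : Measure (Euc n)))
    (fun u : Euc n => ‖u‖ ^ (-((n : ℝ) - 2)) * ff Q (u - b)) b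
  simp only [add_sub_cancel_right] at h'
  have e : ∀ z : Euc n, ‖z + b‖ ^ (-((n : ℝ) - 2)) * |Q z| ^ (pexp n - 1) * Q z
      = ‖z + b‖ ^ (-((n : ℝ) - 2)) * ff Q z := fun z => by rw [ff, mul_assoc]
  simp_rw [e]
  rw [h', h]
  have : Nonempty (Fin n) := ⟨⟨0, by omega⟩⟩
  apply integral_congr_ae
  have hae : ∀ᵐ y : Euc n, y ≠ 0 := by
    rw [ae_iff]; simp
  filter_upwards [hae] with y hy
  have hp : 0 < ‖y‖ := norm_pos_iff.2 hy
  rw [gg, norm_iv, ← mul_assoc]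
  congr 1
  rw [Real.inv_rpow hp.le, ← Real.rpow_neg hp.le, ← pow_mul, inv_pow, ← Real.rpow_natCast,
    ← Real.rpow_neg hp.le, ← Real.rpow_add hp]
  congr 1
  push_cast
  ring

lemma pexp_pos {n : ℕ} (hn : 3 ≤ n) : 0 < pexp n ∧ 0 < pexp n - 1 ∧
    ((n : ℝ) - 2) * pexp n = n + 2 := by
  have : (3 : ℝ) ≤ n := by exact_mod_cast hn
  have h : (0 : ℝ) < n - 2 := by linarith
  refine ⟨by unfold pexp; positivity, ?_, by unfold pexp; field_simp⟩
  unfold pexp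
  rw [sub_pos, lt_div_iff₀ h]
  linarith

lemma abs_ff {n : ℕ} (hn : 3 ≤ n) (Q : Euc n → ℝ) (z : Euc n) :
    |ff Q z| = |Q z| ^ (pexp n) := by
  obtain ⟨h0, h1, -⟩ := pexp_pos hn
  rw [ff, abs_mul, abs_of_nonneg (Real.rpow_nonneg (abs_nonneg _) _)]
  conv_lhs => rw [← Real.rpow_one |Q z|]
  rw [← Real.rpow_mul (abs_nonneg _), one_mul, ← Real.rpow_add_of_nonneg (abs_nonneg _) h1.le zero_le_one]
  congr 1
  ring

lemma ff_bound {n : ℕ} (hn : 3 ≤ n) (Q : Euc n → ℝ) (C₀ : ℝ) (hC₀ : 0 < C₀)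
    (hQdec : ∀ y : Euc n, |Q y| ≤ C₀ * (1 + ‖y‖) ^ (-((n : ℝ) - 2))) (z : Euc n) :
    |ff Q z| ≤ C₀ ^ (pexp n) * (1 + ‖z‖) ^ (-((n : ℝ) + 2)) := by
  obtain ⟨h0, h1, h2⟩ := pexp_pos hn
  rw [abs_ff hn]
  refine (Real.rpow_le_rpow (abs_nonneg _) (hQdec z) h0.le).trans_eq ?_
  rw [Real.mul_rpow hC₀.le (by positivity), ← Real.rpow_mul (by positivity), neg_mul, h2]

lemma gg_bound {n : ℕ} (hn : 3 ≤ n) (Q : Euc n → ℝ) (C₀ : ℝ) (hC₀ : 0 < C₀)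
    (hQdec : ∀ y : Euc n, |Q y| ≤ C₀ * (1 + ‖y‖) ^ (-((n : ℝ) - 2))) (b : Euc n)
    (hb : ‖b‖ < 1 / 2) (y : Euc n) :
    |gg Q b y| ≤ C₀ ^ (pexp n) * 2 ^ ((n : ℝ) + 2) * (1 + ‖y‖) ^ (-((n : ℝ) + 2)) := by
  have hf := ff_bound hn Q C₀ hC₀ hQdec (iv y - b)
  by_cases hy : y = 0
  · rw [gg, hy, norm_zero, Real.zero_rpow (by linarith [Nat.cast_nonneg (α := ℝ) n]), zero_mul, abs_zero]
    positivity
  have hp : 0 < ‖y‖ := norm_pos_iff.2 hy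
  rw [gg, abs_mul, abs_of_nonneg (by positivity)]
  have hz : 1 + ‖y‖⁻¹ ≤ 2 * (1 + ‖iv y - b‖) := by
    have := norm_sub_norm_le (iv y) b
    rw [norm_iv] at this
    have := inv_pos.2 hp
    linarith [norm_nonneg (iv y - b)]
  have hz' : (1 + ‖y‖) / 2 ≤ ‖y‖ * (1 + ‖iv y - b‖) := by
    have := mul_le_mul_of_nonneg_left hz hp.le
    rw [mul_add, mul_inv_cancel₀ hp.ne'] at this
    linarith
  calc ‖y‖ ^ (-((n : ℝ) + 2)) * |ff Q (iv y - b)|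
      ≤ ‖y‖ ^ (-((n : ℝ) + 2)) * (C₀ ^ (pexp n) * (1 + ‖iv y - b‖) ^ (-((n : ℝ) + 2))) := by gcongr
    _ = C₀ ^ (pexp n) * (‖y‖ * (1 + ‖iv y - b‖)) ^ (-((n : ℝ) + 2)) := by
        rw [Real.mul_rpow hp.le (by positivity)]; ring
    _ ≤ C₀ ^ (pexp n) * ((1 + ‖y‖) / 2) ^ (-((n : ℝ) + 2)) := by
        refine mul_le_mul_of_nonneg_left ?_ (by positivity)
        exact Real.rpow_le_rpow_of_nonpos (by positivity) hz' (by linarith [Nat.cast_nonneg (α := ℝ) n])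
    _ = _ := by
        rw [Real.div_rpow (by positivity) (by positivity), Real.rpow_neg (x := 2) (by positivity), div_inv_eq_mul]
        ring

lemma gg_meas {n : ℕ} (Q : Euc n → ℝ) (hQ : Continuous Q) (b : Euc n) : Measurable (gg Q b) := by
  have := hQ.measurable
  unfold gg ff iv
  fun_prop

lemma gg_int {n : ℕ} (hn : 3 ≤ n) (Q : Euc n → ℝ) (hQ : Continuous Q) (C₀ : ℝ) (hC₀ : 0 < C₀)
    (hQdec : ∀ y : Euc n, |Q y| ≤ C₀ * (1 + ‖y‖) ^ (-((n : ℝ) - 2))) (b : Euc n)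
    (hb : ‖b‖ < 1 / 2) : Integrable (gg Q b) := by
  have h : Integrable (fun y : Euc n => (1 + ‖y‖) ^ (-((n : ℝ) + 2))) :=
    integrable_one_add_norm (by simp)
  exact (h.const_mul (C₀ ^ (pexp n) * 2 ^ ((n : ℝ) + 2))).mono' (gg_meas Q hQ b).aestronglyMeasurable
    (Eventually.of_forall fun y => gg_bound hn Q C₀ hC₀ hQdec b hb y)

lemma QA_eq {n : ℕ} (Q : Euc n → ℝ)
    (hKelvin : ∀ y : Euc n, y ≠ 0 → Q y = ‖y‖ ^ ((2 : ℝ) - n) * Q ((‖y‖ ^ 2)⁻¹ • y))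
    (lam : ℝ) (hl : 0 < lam) (ξ a : Euc n) (R : Euc n ≃ₗᵢ[ℝ] Euc n) (x y : Euc n)
    (hx : x - ξ = lam • y) (hy : y ≠ 0) (hz : iv y - R a ≠ 0) :
    QA Q lam ξ a R x = lam ^ (-(((n : ℝ) - 2) / 2)) * ‖y‖ ^ ((2 : ℝ) - n) * Q (iv y - R a) := by
  have hp : 0 < ‖y‖ := norm_pos_iff.2 hy
  set z := iv y - R a with hzd
  have hzp : 0 < ‖z‖ := norm_pos_iff.2 hz
  have e0 : lam⁻¹ • (x - ξ) = y := by rw [hx, smul_smul, inv_mul_cancel₀ hl.ne', one_smul]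
  have e1 : (‖x - ξ‖⁻¹) • (x - ξ) - (‖x - ξ‖ / lam) • (R a) = ‖y‖ • z := by
    rw [hx, norm_smul, Real.norm_of_nonneg hl.le, smul_smul, hzd, iv, smul_sub, smul_smul]
    congr 2 <;> field_simp
  have e2 : y - ‖y‖ ^ 2 • (R a) = ‖y‖ ^ 2 • z := by
    rw [hzd, iv, smul_sub, smul_smul, mul_inv_cancel₀ (by positivity), one_smul]
  have e3 : 1 - 2 * ⟪R a, y⟫ + ‖a‖ ^ 2 * ‖y‖ ^ 2 = ‖y‖ ^ 2 * ‖z‖ ^ 2 := by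
    have h4 : ‖z‖ ^ 2 = (‖y‖⁻¹) ^ 2 - 2 * ((‖y‖ ^ 2)⁻¹ * ⟪R a, y⟫) + ‖a‖ ^ 2 := by
      rw [hzd, norm_sub_sq_real, norm_iv, LinearIsometryEquiv.norm_map, iv, real_inner_smul_left,
        real_inner_comm]
    rw [h4]
    field_simp
  rw [QA, e0, e1, e2, e3, smul_smul]
  have e5 : (‖y‖ ^ 2 * ‖z‖ ^ 2)⁻¹ * ‖y‖ ^ 2 = (‖z‖ ^ 2)⁻¹ := by field_simp
  rw [e5, hKelvin z hz, norm_smul, norm_norm, Real.mul_rpow hp.le hzp.le]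
  ring

lemma ff_QA {n : ℕ} (hn : 3 ≤ n) (Q : Euc n → ℝ)
    (hKelvin : ∀ y : Euc n, y ≠ 0 → Q y = ‖y‖ ^ ((2 : ℝ) - n) * Q ((‖y‖ ^ 2)⁻¹ • y))
    (lam : ℝ) (hl : 0 < lam) (ξ a : Euc n) (R : Euc n ≃ₗᵢ[ℝ] Euc n) (x y : Euc n)
    (hx : x - ξ = lam • y) (hy : y ≠ 0) (hz : iv y - R a ≠ 0) :
    |QA Q lam ξ a R x| ^ (pexp n - 1) * QA Q lam ξ a R x
      = lam ^ (-(((n : ℝ) + 2) / 2)) * gg Q (R a) y := by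
  obtain ⟨h0, h1, h2⟩ := pexp_pos hn
  have hp : 0 < ‖y‖ := norm_pos_iff.2 hy
  rw [QA_eq Q hKelvin lam hl ξ a R x y hx hy hz, gg, ff]
  set q := Q (iv y - R a)
  have k1 : 0 < lam ^ (-(((n : ℝ) - 2) / 2)) := by positivity
  have k2 : 0 < ‖y‖ ^ ((2 : ℝ) - n) := by positivity
  have key : ∀ t : ℝ, 0 < t → t ^ (pexp n - 1) * t = t ^ pexp n := fun t ht => by
    rw [Real.rpow_sub_one ht.ne']; field_simp
  rw [abs_mul, abs_mul, abs_of_pos k1, abs_of_pos k2, Real.mul_rpow (by positivity) (abs_nonneg _),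
    Real.mul_rpow k1.le k2.le]
  have k3 := key _ k1
  have k4 := key _ k2
  rw [← Real.rpow_mul hl.le] at k3
  rw [← Real.rpow_mul hp.le] at k4
  have l3 : -(((n : ℝ) - 2) / 2) * pexp n = -(((n : ℝ) + 2) / 2) := by rw [← h2]; ring
  have l4 : ((2 : ℝ) - n) * pexp n = -((n : ℝ) + 2) := by rw [← h2]; ring
  rw [← Real.rpow_mul hl.le, l3] at k3
  rw [← Real.rpow_mul hp.le, l4] at k4
  rw [← k3, ← k4, ← Real.rpow_mul hl.le, ← Real.rpow_mul hp.le]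
  ring

lemma scale_int {n : ℕ} (G : Euc n → ℝ) (lam : ℝ) (hl : 0 < lam) (ξ : Euc n) :
    ∫ x, G (lam⁻¹ • (x - ξ)) = lam ^ n * ∫ y, G y := by
  rw [integral_sub_right_eq_self (fun x => G (lam⁻¹ • x)) ξ, Measure.integral_comp_inv_smul]
  simp [abs_of_pos (pow_pos hl n)]

lemma tail_bound {n : ℕ} (g : Euc n → ℝ) (K r M : ℝ) (hK : 0 ≤ K) (hr : 0 ≤ r) (hM : 0 < M)
    (hg : ∀ y, |g y| ≤ K * (1 + ‖y‖) ^ (-((n : ℝ) + 2))) (c : Euc n) (T : Set (Euc n))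
    (hTm : MeasurableSet T) (hT : ∀ y ∈ T, y ∈ closedBall c r ∨ M ≤ ‖y‖) :
    |∫ y in T, g y| ≤ K * (r ^ n * volume.real (ball (0 : Euc n) 1)
      + 2 ^ ((n : ℝ) + 2) * (M ^ 2)⁻¹ * ∫ y : Euc n, (1 + ‖y‖) ^ (-((n : ℝ) + 2))) := by
  set h : Euc n → ℝ := fun y => (1 + ‖y‖) ^ (-((n : ℝ) + 2)) with hh
  have hint : Integrable h := integrable_one_add_norm (by simp)
  have hint' : Integrable (fun y => h (M⁻¹ • y)) := hint.comp_smul (inv_ne_zero hM.ne')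
  have hindi : Integrable ((closedBall c r).indicator (fun _ : Euc n => (1 : ℝ))) :=
    (integrable_indicator_iff measurableSet_closedBall).2
      (integrableOn_const (measure_closedBall_lt_top).ne)
  have hn0 : (0 : ℝ) ≤ n := Nat.cast_nonneg n
  rw [← integral_indicator hTm, ← Real.norm_eq_abs]
  have main := norm_integral_le_of_norm_le (μ := (volume : Measure (Euc n))) (f := T.indicator g)
    ((hindi.add (hint'.const_mul (2 ^ ((n : ℝ) + 2) * M ^ (-((n : ℝ) + 2))))).const_mul K) ?_
  · refine main.trans_eq ?_
    rw [integral_const_mul]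
    congr 1
    rw [integral_add' hindi (hint'.const_mul _), integral_const_mul, Measure.integral_comp_inv_smul,
      integral_indicator measurableSet_closedBall]
    congr 1
    · rw [setIntegral_const, smul_eq_mul, mul_one, Measure.addHaar_real_closedBall _ _ hr]
      simp
    · rw [finrank_euclideanSpace_fin, abs_of_pos (by positivity), smul_eq_mul, ← mul_assoc]
      congr 1
      rw [mul_assoc]
      congr 1
      rw [← Real.rpow_natCast M n, ← Real.rpow_add hM, ← Real.rpow_natCast M 2,
        ← Real.rpow_neg hM.le]
      congr 1
      push_cast
      ring
  · refine Eventually.of_forall fun y => ?_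
    have hpos : ∀ u, 0 ≤ h u := fun u => by rw [hh]; positivity
    have hi0 : 0 ≤ (closedBall c r).indicator (fun _ : Euc n => (1 : ℝ)) y :=
      indicator_nonneg (fun _ _ => zero_le_one) y
    have hq : 0 ≤ (2 ^ ((n : ℝ) + 2) * M ^ (-((n : ℝ) + 2))) * h (M⁻¹ • y) :=
      mul_nonneg (by positivity) (hpos _)
    by_cases hy : y ∈ T
    · rw [indicator_of_mem hy, Real.norm_eq_abs]
      refine (hg y).trans ?_
      refine mul_le_mul_of_nonneg_left ?_ hK
      rw [Pi.add_apply]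
      rcases hT y hy with hb | hb
      · rw [indicator_of_mem hb]
        have : (1 + ‖y‖) ^ (-((n : ℝ) + 2)) ≤ 1 :=
          Real.rpow_le_one_of_one_le_of_nonpos (by linarith [norm_nonneg y]) (by linarith)
        linarith
      · have : (1 + ‖y‖) ^ (-((n : ℝ) + 2))
            ≤ (2 ^ ((n : ℝ) + 2) * M ^ (-((n : ℝ) + 2))) * h (M⁻¹ • y) := by
          have e : (2 ^ ((n : ℝ) + 2) * M ^ (-((n : ℝ) + 2))) * h (M⁻¹ • y)
              = (2⁻¹ * M * (1 + ‖M⁻¹ • y‖)) ^ (-((n : ℝ) + 2)) := by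
            rw [Real.mul_rpow (by positivity) (by positivity),
              Real.mul_rpow (by positivity) hM.le, Real.inv_rpow (by positivity),
              Real.rpow_neg (x := 2) (by positivity), inv_inv]
          rw [e]
          refine Real.rpow_le_rpow_of_nonpos (by positivity) ?_ (by linarith)
          rw [norm_smul, norm_inv, Real.norm_of_nonneg hM.le]
          have : 2⁻¹ * M * (1 + M⁻¹ * ‖y‖) = 2⁻¹ * (M + ‖y‖) := by field_simp
          rw [this]
          linarith
        linarith
    · rw [indicator_of_notMem hy, norm_zero]
      exact mul_nonneg hK (add_nonneg hi0 hq)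

/-- For every fixed small `δ > 0` there is `C > 0` such that for all small `ε`
and all admissible parameters,
`|∫_{ε<|x|<δ} |Q_A|^{p-1} Q_A dx - λ^{(n-2)/2} ∫_{ℝⁿ} |z + R_θ a|^{-(n-2)} |Q|^{p-1} Q dz|
  ≤ C λ^{(n+2)/2}`. -/
theorem statement17 (n : ℕ) (hn : 3 ≤ n)
    (Q : Euc n → ℝ) (hQcont : Continuous Q) (C₀ : ℝ) (hC₀ : 0 < C₀)
    (hQdec : ∀ y : Euc n, |Q y| ≤ C₀ * (1 + ‖y‖) ^ (-((n : ℝ) - 2)))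
    (hKelvin : ∀ y : Euc n, y ≠ 0 → Q y = ‖y‖ ^ ((2 : ℝ) - n) * Q ((‖y‖ ^ 2)⁻¹ • y))
    (η : ℝ) (hη : 0 < η) (δ : ℝ) (hδ : 0 < δ) :
    ∃ C : ℝ, 0 < C ∧ ∃ ε₀ : ℝ, 0 < ε₀ ∧
      ∀ (ε d lam : ℝ) (τ a : Euc n) (R : Euc n ≃ₗᵢ[ℝ] Euc n),
        0 < ε → ε < ε₀ → η < d → d < η⁻¹ → lam = d * Real.sqrt ε → ‖τ‖ < η →
        (∀ i : Fin n, 2 ≤ (i : ℕ) → a i = 0) → ‖a‖ < 1 / 2 →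
        LinearMap.det (R.toLinearEquiv.toLinearMap) = 1 →
        |(∫ x in Metric.ball (0 : Euc n) δ \ Metric.closedBall 0 ε,
              |QA Q lam (lam • τ) a R x| ^ (pexp n - 1) * QA Q lam (lam • τ) a R x)
          - lam ^ (((n : ℝ) - 2) / 2) *
              (∫ z : Euc n, ‖z + R a‖ ^ (-((n : ℝ) - 2)) * |Q z| ^ (pexp n - 1) * Q z)|
        ≤ C * lam ^ (((n : ℝ) + 2) / 2) := by
  obtain ⟨hp0, hp1, hp2⟩ := pexp_pos hn
  have : Nonempty (Fin n) := ⟨⟨0, by omega⟩⟩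
  set K : ℝ := C₀ ^ (pexp n) * 2 ^ ((n : ℝ) + 2) with hKd
  have hK : 0 < K := by positivity
  set H : ℝ := ∫ y : Euc n, (1 + ‖y‖) ^ (-((n : ℝ) + 2)) with hH
  have hH0 : 0 ≤ H := integral_nonneg fun y => by positivity
  set V : ℝ := volume.real (ball (0 : Euc n) 1) with hV
  have hV0 : 0 ≤ V := measureReal_nonneg
  refine ⟨K * ((η⁻¹ ^ 2) ^ n * η⁻¹ ^ (n - 2) * V + 2 ^ ((n : ℝ) + 2) * ((2 / δ) ^ 2) * H) + 1,
    by positivity, (min 1 (δ / 2)) ^ 2, by positivity, ?_⟩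
  intro ε d lam τ a R hε hεs hd1 hd2 hlam hτ _ ha _
  have hd : 0 < d := hη.trans hd1
  have hs : 0 < Real.sqrt ε := Real.sqrt_pos.2 hε
  have hl : 0 < lam := by rw [hlam]; positivity
  have hsε : Real.sqrt ε < min 1 (δ / 2) := by
    rw [Real.sqrt_lt' (by positivity)]; exact hεs
  have hs1 : Real.sqrt ε < 1 := hsε.trans_le (min_le_left _ _)
  have hs2 : Real.sqrt ε < δ / 2 := hsε.trans_le (min_le_right _ _)
  have hlη : lam ≤ η⁻¹ * Real.sqrt ε := by rw [hlam]; gcongr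
  have hl1 : lam ≤ η⁻¹ := hlη.trans (by
    have := inv_pos.2 hη
    nlinarith)
  have hlτ : lam * ‖τ‖ ≤ δ / 2 := by
    calc lam * ‖τ‖ ≤ (η⁻¹ * Real.sqrt ε) * η := by gcongr
      _ = Real.sqrt ε := by field_simp
      _ ≤ δ / 2 := hs2.le
  have hεl : ε ≤ lam * (lam * η⁻¹ ^ 2) := by
    have e1 : ε = Real.sqrt ε * Real.sqrt ε := (Real.mul_self_sqrt hε.le).symm
    have e2 : 1 ≤ d * η⁻¹ := by
      rw [← div_eq_mul_inv, le_div_iff₀ hη]; linarith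
    have e3 : lam * (lam * η⁻¹ ^ 2) = ε * (d * η⁻¹) ^ 2 := by
      rw [hlam]
      nth_rewrite 3 [e1]
      ring
    rw [e3]
    have : 1 ≤ (d * η⁻¹) ^ 2 := one_le_pow₀ e2
    nlinarith
  set b := R a with hbd
  have hb : ‖b‖ < 1 / 2 := by rw [hbd, LinearIsometryEquiv.norm_map]; exact ha
  have hgi := gg_int hn Q hQcont C₀ hC₀ hQdec b hb
  have hgb := gg_bound hn Q C₀ hC₀ hQdec b hb
  set S : Set (Euc n) := Metric.ball (0 : Euc n) δ \ Metric.closedBall 0 ε with hS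
  have hSm : MeasurableSet S := measurableSet_ball.diff measurableSet_closedBall
  set ξ := lam • τ with hξ
  set S' : Set (Euc n) := (fun y => lam • y + ξ) ⁻¹' S with hS'
  have hSm' : MeasurableSet S' := hSm.preimage (by fun_prop)
  have A1 : ∫ x in S, |QA Q lam ξ a R x| ^ (pexp n - 1) * QA Q lam ξ a R x
      = lam ^ (((n : ℝ) - 2) / 2) * ∫ y in S', gg Q b y := by
    have B1 : ∫ x in S, |QA Q lam ξ a R x| ^ (pexp n - 1) * QA Q lam ξ a R x
        = ∫ x, lam ^ (-(((n : ℝ) + 2) / 2)) * (S'.indicator (gg Q b)) (lam⁻¹ • (x - ξ)) := by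
      rw [← integral_indicator hSm]
      apply integral_congr_ae
      have n1 : ∀ᵐ x : Euc n, x ≠ ξ := by rw [ae_iff]; simp
      have n2 : ∀ᵐ x : Euc n, x ≠ lam • iv b + ξ := by rw [ae_iff]; simp
      filter_upwards [n1, n2] with x hx1 hx2
      have hx : x - ξ = lam • (lam⁻¹ • (x - ξ)) := by
        rw [smul_smul, mul_inv_cancel₀ hl.ne', one_smul]
      have hmem : lam⁻¹ • (x - ξ) ∈ S' ↔ x ∈ S := by
        rw [hS', mem_preimage, ← hx, sub_add_cancel]
      by_cases hxS : x ∈ S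
      · rw [indicator_of_mem hxS, indicator_of_mem (hmem.2 hxS)]
        apply ff_QA hn Q hKelvin lam hl ξ a R x _ hx
        · exact smul_ne_zero (inv_ne_zero hl.ne') (sub_ne_zero.2 hx1)
        · intro h0
          apply hx2
          rw [sub_eq_zero] at h0
          rw [hbd, ← h0, iv_iv, ← hx, sub_add_cancel]
      · rw [indicator_of_notMem hxS, indicator_of_notMem (fun h => hxS (hmem.1 h)), mul_zero]
    rw [B1, integral_const_mul, scale_int _ lam hl, integral_indicator hSm', ← mul_assoc]
    congr 1
    rw [← Real.rpow_natCast, ← Real.rpow_add hl]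
    congr 1
    ring
  rw [A1, integral_gg hn Q b, ← integral_add_compl hSm' hgi, ← mul_sub]
  have A2 : |∫ y in S'ᶜ, gg Q b y| ≤ _ := tail_bound (gg Q b) K (lam * η⁻¹ ^ 2) (δ / (2 * lam))
    hK.le (by positivity) (by positivity) hgb (-τ) S'ᶜ hSm'.compl (by
      intro y hy
      have hyS : lam • y + ξ ∉ S := hy
      have e : lam • y + ξ = lam • (y + τ) := by rw [hξ, smul_add]
      rw [e, hS, mem_diff, mem_ball_zero_iff, mem_closedBall_zero_iff, norm_smul,
        Real.norm_of_nonneg hl.le] at hyS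
      rw [mem_closedBall, dist_eq_norm, sub_neg_eq_add]
      by_cases h1 : lam * ‖y + τ‖ < δ
      · left
        have h2 : lam * ‖y + τ‖ ≤ ε := by
          by_contra h3
          exact hyS ⟨h1, h3⟩
        exact le_of_mul_le_mul_left (h2.trans hεl) hl
      · right
        rw [div_le_iff₀ (by positivity)]
        have h3 : lam * ‖y + τ‖ ≤ lam * (‖y‖ + ‖τ‖) := by
          gcongr
          exact norm_add_le _ _
        linarith)
  have A3 : K * ((lam * η⁻¹ ^ 2) ^ n * V + 2 ^ ((n : ℝ) + 2) * ((δ / (2 * lam)) ^ 2)⁻¹ * H)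
      ≤ (K * ((η⁻¹ ^ 2) ^ n * η⁻¹ ^ (n - 2) * V + 2 ^ ((n : ℝ) + 2) * ((2 / δ) ^ 2) * H) + 1)
        * lam ^ 2 := by
    have e1 : lam ^ n ≤ η⁻¹ ^ (n - 2) * lam ^ 2 := by
      have : lam ^ n = lam ^ (n - 2) * lam ^ 2 := by rw [← pow_add]; congr 1; omega
      rw [this]
      gcongr
    have e2 : ((δ / (2 * lam)) ^ 2)⁻¹ = (2 / δ) ^ 2 * lam ^ 2 := by field_simp
    rw [e2, mul_pow]
    have e3 : lam ^ n * (η⁻¹ ^ 2) ^ n * V ≤ η⁻¹ ^ (n - 2) * lam ^ 2 * (η⁻¹ ^ 2) ^ n * V := by gcongr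
    have e4 := mul_le_mul_of_nonneg_left e3 hK.le
    have e5 : 0 ≤ lam ^ 2 := by positivity
    linarith
  have e6 : lam ^ (((n : ℝ) + 2) / 2) = lam ^ (((n : ℝ) - 2) / 2) * lam ^ 2 := by
    rw [← Real.rpow_natCast, ← Real.rpow_add hl]
    congr 1
    push_cast
    ring
  have e7 : 0 < lam ^ (((n : ℝ) - 2) / 2) := by positivity
  rw [sub_add_cancel_left, mul_neg, abs_neg, abs_mul, abs_of_pos e7, e6, mul_left_comm]
  exact mul_le_mul_of_nonneg_left (A2.trans A3) e7.le
end
end
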